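/- Let L be a modal team logic invariant under team bisimulation and ∃̃L its extension by the existential bisimulation quantifier. For every formula φ of ∃̃L and propositional letter p, the formula ∃̃p φ is a uniform interpolant for φ in ∃̃L with respect to Free(φ)∖{p}: (1) φ ⊨ ∃̃p φ; (2) whenever φ ⊨ ψ for ψ ∈ ∃̃L with Free(φ)∩Free(ψ) ⊆ Free(φ)∖{p}, then ∃̃p φ ⊨ ψ; (3) Free(∃̃p φ) = Free(φ)∖{p}. -/

import Mathlib

/-- A Kripke model `M = (W, R, V)` over a set `V` of propositional letters. -/
structure KModel (V : Type) : Type 1 where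
  W : Type
  R : W → W → Prop
  val : W → V → Prop

variable {V : Type}

/-- `B` is a `P`-bisimulation between the Kripke models `M` and `N`:
related points agree on all propositions of `P`, and `B` satisfies the
forth and back conditions. -/
def IsBisim (P : Set V) (M N : KModel V) (B : M.W → N.W → Prop) : Prop :=
  (∀ w v, B w v → ∀ p ∈ P, (M.val w p ↔ N.val v p)) ∧
  (∀ w v, B w v → ∀ w', M.R w w' → ∃ v', N.R v v' ∧ B w' v') ∧
  (∀ w v, B w v → ∀ v', N.R v v' → ∃ w', M.R w w' ∧ B w' v')

/-- `(M,w) ⇌_P (N,v)`: some `P`-bisimulation relates `w` and `v`. -/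
def Bisimilar (P : Set V) (M : KModel V) (w : M.W) (N : KModel V) (v : N.W) : Prop :=
  ∃ B, IsBisim P M N B ∧ B w v

/-- Team `P`-bisimulation `(M,X) ⇌_P (N,Y)`: every point of `X` is
`P`-bisimilar to some point of `Y` and conversely. -/
def TeamBisim (P : Set V) (M : KModel V) (X : Set M.W) (N : KModel V) (Y : Set N.W) : Prop :=
  (∀ x ∈ X, ∃ y ∈ Y, Bisimilar P M x N y) ∧
  (∀ y ∈ Y, ∃ x ∈ X, Bisimilar P M x N y)

/-- An (abstract) modal team logic `L`: a type of formulas together with a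
set of free variables and a team satisfaction relation for each formula. -/
structure TeamLogic (V : Type) : Type 1 where
  F : Type
  Free : F → Set V
  Sat : (M : KModel V) → Set M.W → F → Prop

/-- Formulas of `∃̃L`, the extension of `L` by the existential bisimulation
quantifier. -/
inductive ExtForm (V : Type) (F : Type) : Type where
  | base : F → ExtForm V F
  | exq : V → ExtForm V F → ExtForm V F

variable {V : Type}

/-- Free variables of an `∃̃L` formula: `Free(∃̃p φ) = Free(φ) \ {p}`. -/
def extFree (L : TeamLogic V) : ExtForm V L.F → Set V
  | .base b => L.Free b
  | .exq p φ => extFree L φ \ {p}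

/-- Team semantics of `∃̃L`: `(M,X) ⊨ ∃̃p φ` iff there is `(M',X')` with
`(M',X') ⇌_{Free(φ)\{p}} (M,X)` and `(M',X') ⊨ φ`. -/
def extSat (L : TeamLogic V) : (M : KModel V) → Set M.W → ExtForm V L.F → Prop
  | M, X, .base b => L.Sat M X b
  | M, X, .exq p φ => ∃ (M' : KModel V) (X' : Set M'.W),
      TeamBisim (extFree L φ \ {p}) M' X' M X ∧ extSat L M' X' φ

section Bisimulation

variable {V : Type} {P Q : Set V} {M N K : KModel V}

theorem Bisimilar.refl (P : Set V) (M : KModel V) (w : M.W) : Bisimilar P M w M w := by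
  refine ⟨Eq, ⟨?_, ?_, ?_⟩, rfl⟩
  · rintro w _ rfl p _
    rfl
  · rintro w _ rfl w' h
    exact ⟨w', h, rfl⟩
  · rintro w _ rfl w' h
    exact ⟨w', h, rfl⟩

theorem Bisimilar.symm {w : M.W} {v : N.W} (h : Bisimilar P M w N v) : Bisimilar P N v M w := by
  obtain ⟨B, ⟨hval, hforth, hback⟩, hwv⟩ := h
  exact ⟨fun v w => B w v, ⟨fun v w h p hp => (hval w v h p hp).symm,
    fun v w h => hback w v h, fun v w h => hforth w v h⟩, hwv⟩

theorem Bisimilar.trans {w : M.W} {v : N.W} {u : K.W} (h₁ : Bisimilar P M w N v)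
    (h₂ : Bisimilar P N v K u) : Bisimilar P M w K u := by
  obtain ⟨B, ⟨hBval, hBforth, hBback⟩, hB⟩ := h₁
  obtain ⟨C, ⟨hCval, hCforth, hCback⟩, hC⟩ := h₂
  refine ⟨fun w u => ∃ v, B w v ∧ C v u, ⟨?_, ?_, ?_⟩, v, hB, hC⟩
  · rintro w u ⟨v, hB, hC⟩ p hp
    exact (hBval w v hB p hp).trans (hCval v u hC p hp)
  · rintro w u ⟨v, hB, hC⟩ w' hw
    obtain ⟨v', hv, hB'⟩ := hBforth w v hB w' hw
    obtain ⟨u', hu, hC'⟩ := hCforth v u hC v' hv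
    exact ⟨u', hu, v', hB', hC'⟩
  · rintro w u ⟨v, hB, hC⟩ u' hu
    obtain ⟨v', hv, hC'⟩ := hCback v u hC u' hu
    obtain ⟨w', hw, hB'⟩ := hBback w v hB v' hv
    exact ⟨w', hw, v', hB', hC'⟩

theorem Bisimilar.mono (hPQ : P ⊆ Q) {w : M.W} {v : N.W} (h : Bisimilar Q M w N v) :
    Bisimilar P M w N v := by
  obtain ⟨B, ⟨hval, hforth, hback⟩, hwv⟩ := h
  exact ⟨B, ⟨fun w v h p hp => hval w v h p (hPQ hp), hforth, hback⟩, hwv⟩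

theorem Bisimilar.val_iff {w : M.W} {v : N.W} (h : Bisimilar P M w N v) {p : V} (hp : p ∈ P) :
    M.val w p ↔ N.val v p := by
  obtain ⟨B, hB, hwv⟩ := h
  exact hB.1 w v hwv p hp

theorem Bisimilar.forth {w w' : M.W} {v : N.W} (h : Bisimilar P M w N v) (hw : M.R w w') :
    ∃ v', N.R v v' ∧ Bisimilar P M w' N v' := by
  obtain ⟨B, hB, hwv⟩ := h
  obtain ⟨v', hv, hB'⟩ := hB.2.1 w v hwv w' hw
  exact ⟨v', hv, B, hB, hB'⟩

theorem Bisimilar.back {w : M.W} {v v' : N.W} (h : Bisimilar P M w N v) (hv : N.R v v') :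
    ∃ w', M.R w w' ∧ Bisimilar P M w' N v' := by
  obtain ⟨w', hw, h'⟩ := h.symm.forth hv
  exact ⟨w', hw, h'.symm⟩

theorem TeamBisim.refl (P : Set V) (M : KModel V) (X : Set M.W) : TeamBisim P M X M X :=
  ⟨fun x hx => ⟨x, hx, .refl P M x⟩, fun x hx => ⟨x, hx, .refl P M x⟩⟩

theorem TeamBisim.trans {X : Set M.W} {Y : Set N.W} {Z : Set K.W} (h₁ : TeamBisim P M X N Y)
    (h₂ : TeamBisim P N Y K Z) : TeamBisim P M X K Z := by
  constructor
  · intro x hx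
    obtain ⟨y, hy, hxy⟩ := h₁.1 x hx
    obtain ⟨z, hz, hyz⟩ := h₂.1 y hy
    exact ⟨z, hz, hxy.trans hyz⟩
  · intro z hz
    obtain ⟨y, hy, hyz⟩ := h₂.2 z hz
    obtain ⟨x, hx, hxy⟩ := h₁.2 y hy
    exact ⟨x, hx, hxy.trans hyz⟩

theorem TeamBisim.mono (hPQ : P ⊆ Q) {X : Set M.W} {Y : Set N.W} (h : TeamBisim Q M X N Y) :
    TeamBisim P M X N Y :=
  ⟨fun x hx => (h.1 x hx).imp fun _ hy => ⟨hy.1, hy.2.mono hPQ⟩,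
    fun y hy => (h.2 y hy).imp fun _ hx => ⟨hx.1, hx.2.mono hPQ⟩⟩

/-- The amalgam of `M` and `N` over `P ∩ Q`: the pairs of `P ∩ Q`-bisimilar points, with letters
of `P` evaluated in `M` and all other letters in `N`. -/
def amalgam (P Q : Set V) (M N : KModel V) : KModel V where
  W := {k : M.W × N.W // Bisimilar (P ∩ Q) M k.1 N k.2}
  R k l := M.R k.1.1 l.1.1 ∧ N.R k.1.2 l.1.2
  val k p := (p ∈ P ∧ M.val k.1.1 p) ∨ (p ∉ P ∧ N.val k.1.2 p)

theorem bisimilar_amalgam_fst (k : (amalgam P Q M N).W) :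
    Bisimilar P M k.1.1 (amalgam P Q M N) k := by
  refine ⟨fun w l => l.1.1 = w, ⟨?_, ?_, ?_⟩, rfl⟩
  · rintro _ l rfl p hp
    simp [amalgam, hp]
  · rintro _ l rfl w' hw
    obtain ⟨v', hv, h'⟩ := l.2.forth hw
    exact ⟨⟨(w', v'), h'⟩, ⟨hw, hv⟩, rfl⟩
  · rintro _ l rfl l' hl
    exact ⟨l'.1.1, hl.1, rfl⟩

theorem bisimilar_amalgam_snd (k : (amalgam P Q M N).W) :
    Bisimilar Q (amalgam P Q M N) k N k.1.2 := by
  refine ⟨fun l v => l.1.2 = v, ⟨?_, ?_, ?_⟩, rfl⟩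
  · rintro l _ rfl p hp
    by_cases hpP : p ∈ P
    · simpa [amalgam, hpP] using l.2.val_iff ⟨hpP, hp⟩
    · simp [amalgam, hpP]
  · rintro l _ rfl l' hl
    exact ⟨l'.1.2, hl.2, rfl⟩
  · rintro l _ rfl v' hv
    obtain ⟨w', hw, h'⟩ := l.2.back hv
    exact ⟨⟨(w', v'), h'⟩, ⟨hw, hv⟩, rfl⟩

/-- Team bisimulations amalgamate. -/
theorem TeamBisim.exists_amalgam {X : Set M.W} {Y : Set N.W} (h : TeamBisim (P ∩ Q) M X N Y) :
    ∃ (K : KModel V) (Z : Set K.W), TeamBisim P M X K Z ∧ TeamBisim Q K Z N Y := by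
  refine ⟨amalgam P Q M N, {k | k.1.1 ∈ X ∧ k.1.2 ∈ Y}, ⟨?_, ?_⟩, ?_, ?_⟩
  · intro x hx
    obtain ⟨y, hy, hxy⟩ := h.1 x hx
    exact ⟨⟨(x, y), hxy⟩, ⟨hx, hy⟩, bisimilar_amalgam_fst ⟨(x, y), hxy⟩⟩
  · intro k hk
    exact ⟨k.1.1, hk.1, bisimilar_amalgam_fst k⟩
  · intro k hk
    exact ⟨k.1.2, hk.2, bisimilar_amalgam_snd k⟩
  · intro y hy
    obtain ⟨x, hx, hxy⟩ := h.2 y hy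
    exact ⟨⟨(x, y), hxy⟩, ⟨hx, hy⟩, bisimilar_amalgam_snd ⟨(x, y), hxy⟩⟩

/-- The extension by bisimulation quantifiers of a bisimulation invariant logic is bisimulation
invariant. -/
theorem extSat_of_teamBisim (L : TeamLogic V)
    (hinv : ∀ (b : L.F) (M N : KModel V) (X : Set M.W) (Y : Set N.W),
      L.Sat M X b → TeamBisim (L.Free b) M X N Y → L.Sat N Y b)
    (φ : ExtForm V L.F) {X : Set M.W} {Y : Set N.W} (hφ : extSat L M X φ)
    (h : TeamBisim (extFree L φ) M X N Y) : extSat L N Y φ := by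
  cases φ with
  | base b => exact hinv b M N X Y hφ h
  | exq p φ =>
    obtain ⟨M', X', hM', hφ'⟩ := hφ
    exact ⟨M', X', hM'.trans h, hφ'⟩

end Bisimulation

/-- if all formulas of `L` are invariant under team
bisimulation, then for every `φ ∈ ∃̃L` and letter `p` the formula `∃̃p φ` is
a uniform interpolant for `φ` in `∃̃L` w.r.t. `Free(φ) \ {p}`:
(1) `φ ⊨ ∃̃p φ`; (2) whenever `φ ⊨ ψ` for `ψ ∈ ∃̃L` with
`Free(φ) ∩ Free(ψ) ⊆ Free(φ) \ {p}`, then `∃̃p φ ⊨ ψ`;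
(3) `Free(∃̃p φ) = Free(φ) \ {p}`. -/
theorem exq_uniform_interpolant {V : Type} (L : TeamLogic V)
    (hinv : ∀ (b : L.F) (M N : KModel V) (X : Set M.W) (Y : Set N.W),
      L.Sat M X b → TeamBisim (L.Free b) M X N Y → L.Sat N Y b)
    (φ : ExtForm V L.F) (p : V) :
    (∀ (M : KModel V) (X : Set M.W),
      extSat L M X φ → extSat L M X (.exq p φ)) ∧
    (∀ ψ : ExtForm V L.F,
      (∀ (M : KModel V) (X : Set M.W), extSat L M X φ → extSat L M X ψ) →
      extFree L φ ∩ extFree L ψ ⊆ extFree L φ \ {p} →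
      ∀ (M : KModel V) (X : Set M.W),
        extSat L M X (.exq p φ) → extSat L M X ψ) ∧
    extFree L (.exq p φ) = extFree L φ \ {p} := by
  refine ⟨fun M X hφ => ⟨M, X, .refl _ M X, hφ⟩, ?_, rfl⟩
  rintro ψ hent hfree M X ⟨M', X', hM', hφ⟩
  obtain ⟨K, Z, hK, hKM⟩ := (hM'.mono hfree).exists_amalgam
  exact extSat_of_teamBisim L hinv ψ (hent K Z (extSat_of_teamBisim L hinv φ hφ hK)) hKM
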